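/- For every integer g ≥ 1 there exists an irreducible triangulation of the orientable surface S_g of genus g with at least ⌊17g/2⌋ vertices; hence V_max(S_g) ≥ ⌊17g/2⌋, where V_max(S) denotes the maximum number of vertices in an irreducible triangulation of S. -/

import Mathlib

open scoped Classical

/-- A combinatorial triangulation of a closed surface: a finite set of triangular
faces (3-element subsets of `ℕ`) such that every edge lies in exactly two faces,
the faces around each vertex form a single cycle (the link condition), and the
whole complex is connected.  The underlying simple graph has as edges the
2-element subsets of faces. -/
structure Triangulation where
  faces : Finset (Finset ℕ)
  faces_nonempty : faces.Nonempty
  card_eq_three : ∀ f ∈ faces, f.card = 3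
  edge_in_two_faces : ∀ e : Finset ℕ, e.card = 2 → (∃ f ∈ faces, e ⊆ f) →
    (faces.filter (fun f => e ⊆ f)).card = 2
  link_connected : ∀ v : ℕ, ∀ f ∈ faces, ∀ g ∈ faces, v ∈ f → v ∈ g →
    Relation.ReflTransGen
      (fun f' g' => f' ∈ faces ∧ g' ∈ faces ∧ v ∈ f' ∧ v ∈ g' ∧ (f' ∩ g').card = 2) f g
  face_connected : ∀ f ∈ faces, ∀ g ∈ faces,
    Relation.ReflTransGen
      (fun f' g' => f' ∈ faces ∧ g' ∈ faces ∧ (f' ∩ g').card = 2) f g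

namespace Triangulation

/-- The vertices spanned by a set of faces. -/
def vertsOf (F : Finset (Finset ℕ)) : Finset ℕ := F.sup id

/-- The edges spanned by a set of triangular faces: all 2-element subsets of faces. -/
def edgesOf (F : Finset (Finset ℕ)) : Finset (Finset ℕ) :=
  (Finset.powersetCard 2 (vertsOf F)).filter (fun e => ∃ f ∈ F, e ⊆ f)

/-- The vertex set of a triangulation. -/
def verts (T : Triangulation) : Finset ℕ := vertsOf T.faces

/-- The edge set of a triangulation. -/
def edges (T : Triangulation) : Finset (Finset ℕ) := edgesOf T.faces

/-- The Euler characteristic `V - E + F` of a triangulation. -/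
def euler (T : Triangulation) : ℤ :=
  (T.verts.card : ℤ) - (T.edges.card : ℤ) + (T.faces.card : ℤ)

/-- The three directed edges of an ordered triple (an oriented triangle). -/
def dedges (t : ℕ × ℕ × ℕ) : Finset (ℕ × ℕ) :=
  {(t.1, t.2.1), (t.2.1, t.2.2), (t.2.2, t.1)}

/-- `σ` is a coherent orientation of the set `F` of triangular faces: it assigns to each
face an oriented triangle with that vertex set, so that no directed edge is used twice
(equivalently, the two faces sharing an edge traverse that edge in opposite directions). -/
def IsCoherent (F : Finset (Finset ℕ)) (σ : Finset ℕ → ℕ × ℕ × ℕ) : Prop :=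
  (∀ f ∈ F, ({(σ f).1, (σ f).2.1, (σ f).2.2} : Finset ℕ) = f) ∧
  (∀ f ∈ F, ∀ g ∈ F, f ≠ g → Disjoint (dedges (σ f)) (dedges (σ g)))

/-- A triangulation is orientable if its faces admit a coherent orientation. -/
def Orientable (T : Triangulation) : Prop := ∃ σ, IsCoherent T.faces σ

/-- `T` is a triangulation of the orientable surface `S_g` of genus `g`
(Euler characteristic `2 - 2g`). -/
def IsS (g : ℕ) (T : Triangulation) : Prop :=
  T.euler = 2 - 2 * (g : ℤ) ∧ T.Orientable

/-- `T` is a triangulation of the nonorientable surface `N_g` of genus `g`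
(Euler characteristic `2 - g`). -/
def IsN (g : ℕ) (T : Triangulation) : Prop :=
  T.euler = 2 - (g : ℤ) ∧ ¬ T.Orientable

/-- The edges of the cyclic vertex sequence `c`. -/
def cycEdges (c : List ℕ) : Finset (Finset ℕ) :=
  (Finset.range c.length).image
    (fun i => ({c.getD i 0, c.getD ((i + 1) % c.length) 0} : Finset ℕ))

/-- `c` is a cycle of the triangulation `T`: at least three distinct vertices,
consecutive ones (cyclically) joined by edges of `T`. -/
def IsCycle (T : Triangulation) (c : List ℕ) : Prop :=
  3 ≤ c.length ∧ c.Nodup ∧ ∀ e ∈ cycEdges c, e ∈ T.edges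

/-- Faces `f` and `g` lie in the same component of `S - C`, where `C` is the closed curve
corresponding to the cycle `c`: they are joined by a chain of faces consecutively sharing
edges that are not edges of the cycle. -/
def SameSide (T : Triangulation) (c : List ℕ) (f g : Finset ℕ) : Prop :=
  Relation.ReflTransGen
    (fun f' g' => f' ∈ T.faces ∧ g' ∈ T.faces ∧ (f' ∩ g').card = 2 ∧
      f' ∩ g' ∉ cycEdges c) f g

/-- The cycle `c` separates the surface: `S - C` is disconnected. -/
def Separating (T : Triangulation) (c : List ℕ) : Prop :=
  ∃ f ∈ T.faces, ∃ g ∈ T.faces, ¬ SameSide T c f g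

/-- The faces in the component of `S - C` containing the face `f`. -/
noncomputable def sideFaces (T : Triangulation) (c : List ℕ) (f : Finset ℕ) :
    Finset (Finset ℕ) :=
  T.faces.filter (fun g => SameSide T c f g)

/-- The Euler characteristic of the component of `f` in the surface cut along the cycle
`c`, capped with a single new face (`+1`). -/
noncomputable def sideEuler (T : Triangulation) (c : List ℕ) (f : Finset ℕ) : ℤ :=
  ((vertsOf (sideFaces T c f)).card : ℤ) - ((edgesOf (sideFaces T c f)).card : ℤ)
    + ((sideFaces T c f).card : ℤ) + 1

/-- The Euler genus `2 - χ` of the capped component of `f` in the surface cut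
along the cycle `c`. -/
noncomputable def sideEulerGenus (T : Triangulation) (c : List ℕ) (f : Finset ℕ) : ℤ :=
  2 - sideEuler T c f

/-- The capped component of `f` in the surface cut along the cycle `c` is orientable. -/
def SideOrientable (T : Triangulation) (c : List ℕ) (f : Finset ℕ) : Prop :=
  ∃ σ, IsCoherent (sideFaces T c f) σ

/-- `c` is a noncontractible separating cycle (NSC): it separates the surface and
neither capped component is a triangulation of the sphere (`χ = 2`). -/
def IsNSC (T : Triangulation) (c : List ℕ) : Prop :=
  IsCycle T c ∧ Separating T c ∧ ∀ f ∈ T.faces, sideEuler T c f ≠ 2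

/-- A coherent orientation of the faces of `T` in which the gluing across the edges of the
cycle `c` is ignored: this orients the surface obtained by cutting along `c`. -/
def IsCutCoherent (T : Triangulation) (c : List ℕ) (σ : Finset ℕ → ℕ × ℕ × ℕ) : Prop :=
  (∀ f ∈ T.faces, ({(σ f).1, (σ f).2.1, (σ f).2.2} : Finset ℕ) = f) ∧
  (∀ f ∈ T.faces, ∀ g ∈ T.faces, f ≠ g → f ∩ g ∉ cycEdges c →
    Disjoint (dedges (σ f)) (dedges (σ g)))

/-- The cycle `c` is orientable-leaving: the surface obtained by cutting along `c`
is orientable. -/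
def OrientableLeaving (T : Triangulation) (c : List ℕ) : Prop :=
  ∃ σ, IsCutCoherent T c σ

/-- A corner of the cycle `c`: a pair `(i, f)` where `f` is a face containing the `i`-th
vertex of `c`. -/
def IsCorner (T : Triangulation) (c : List ℕ) (x : ℕ × Finset ℕ) : Prop :=
  x.1 < c.length ∧ x.2 ∈ T.faces ∧ c.getD x.1 0 ∈ x.2

/-- Two corners lie on a common boundary segment of the surface cut along `c`:
either they are corners at the same cycle vertex whose faces share an edge through that
vertex not lying on the cycle, or they are corners of one face containing a cycle edge,
at the two endpoints of that edge. -/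
def CornerRel (T : Triangulation) (c : List ℕ) (x y : ℕ × Finset ℕ) : Prop :=
  IsCorner T c x ∧ IsCorner T c y ∧
  ((x.1 = y.1 ∧ (x.2 ∩ y.2).card = 2 ∧ c.getD x.1 0 ∈ x.2 ∩ y.2 ∧
      x.2 ∩ y.2 ∉ cycEdges c) ∨
    (y.1 = (x.1 + 1) % c.length ∧ x.2 = y.2 ∧
      ({c.getD x.1 0, c.getD y.1 0} : Finset ℕ) ⊆ x.2))

/-- The cycle `c` is one-sided: cutting the surface along `c` produces a single boundary
cycle, i.e. all corners along `c` lie on one boundary component (the neighborhood of the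
curve is a Möbius band).  A nonseparating cycle is two-sided iff it is not one-sided. -/
def OneSided (T : Triangulation) (c : List ℕ) : Prop :=
  ∀ x y, IsCorner T c x → IsCorner T c y → Relation.EqvGen (CornerRel T c) x y

/-- The 3-cycles (triangles) of the graph of `T`. -/
def triangles (T : Triangulation) : Finset (Finset ℕ) :=
  (Finset.powersetCard 3 T.verts).filter
    (fun t => ∀ e ∈ Finset.powersetCard 2 t, e ∈ T.edges)

/-- An edge of `T` is contractible iff it lies in exactly two 3-cycles of the graph of
`T` (for any triangulation other than `K₄` on the sphere, this is equivalent to the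
contraction of the edge yielding again a triangulation of the same surface). -/
def ContractibleEdge (T : Triangulation) (e : Finset ℕ) : Prop :=
  e ∈ T.edges ∧ (T.triangles.filter (fun t => e ⊆ t)).card = 2

/-- A triangulation is irreducible if it has no contractible edge. -/
def Irreducible (T : Triangulation) : Prop :=
  ∀ e, ¬ ContractibleEdge T e

/-- Two face sets are equivalent if some relabelling of the vertices carries one onto the
other (such a bijection carries faces to faces and hence edges to edges). -/
def FacesEquiv (F F' : Finset (Finset ℕ)) : Prop :=
  ∃ φ : ℕ ≃ ℕ, F' = F.image (fun f => f.image φ)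

/-- Two triangulations are equivalent if some vertex bijection carries faces to faces
(and hence edges to edges). -/
def EquivTri (T T' : Triangulation) : Prop := FacesEquiv T.faces T'.faces

/-- `T'` is obtained from `T` by a diagonal flip: the edge `{a,c}`, lying in the faces
`{a,b,c}` and `{a,c,d}` with `{b,d}` not an edge, is replaced by `{b,d}` and the two
faces by `{a,b,d}` and `{b,c,d}`. -/
def Flip (T T' : Triangulation) : Prop :=
  ∃ a b c d : ℕ, ({a, b, c} : Finset ℕ) ∈ T.faces ∧ ({a, c, d} : Finset ℕ) ∈ T.faces ∧
    b ≠ d ∧ ({b, d} : Finset ℕ) ∉ T.edges ∧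
    T'.faces = (T.faces \ {({a, b, c} : Finset ℕ), ({a, c, d} : Finset ℕ)}) ∪
      {({a, b, d} : Finset ℕ), ({b, c, d} : Finset ℕ)}

/-- Two triangulations are equivalent under diagonal flips if a finite sequence of
diagonal flips transforms one into a triangulation equivalent to the other. -/
def FlipEquiv (T T' : Triangulation) : Prop :=
  ∃ T'' : Triangulation, Relation.ReflTransGen Flip T T'' ∧ EquivTri T'' T'

end Triangulation

namespace Triangulation

section Connectivity

variable {V : Type*}

/-- In a disjoint union of cycles, the two neighbours of a vertex stay connected after the
vertex has been removed. -/
theorem reflTransGen_avoid_of_isCycles [Finite V] {G : SimpleGraph V} (hG : G.IsCycles)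
    {f x y : V} (hx : G.Adj f x) (hy : G.Adj f y) :
    Relation.ReflTransGen (fun a b => G.Adj a b ∧ a ≠ f ∧ b ≠ f) y x := by
  by_cases hxy : x = y
  · subst hxy; exact .refl
  have walk : ∀ {a b : V} (q : (G \ SimpleGraph.fromEdgeSet {s(f, x)}).Walk a b),
      f ∉ q.support →
      Relation.ReflTransGen (fun a b => G.Adj a b ∧ a ≠ f ∧ b ≠ f) a b := by
    intro a b q
    induction q with
    | nil => intro _; exact .refl
    | cons h q ih =>
      intro hf
      rw [SimpleGraph.Walk.support_cons, List.mem_cons, not_or] at hf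
      refine .head ⟨h.1, Ne.symm hf.1, ?_⟩ (ih hf.2)
      rintro rfl
      exact hf.2 q.start_mem_support
  obtain ⟨p, hp⟩ := (hG.reachable_deleteEdges hx).exists_isPath
  cases p with
  | nil => exact absurd hx (G.irrefl)
  | @cons _ z _ h q =>
    rw [SimpleGraph.Walk.cons_isPath_iff] at hp
    have hzx : z ≠ x := by
      rintro rfl
      exact h.2 (by simpa using hx.ne)
    obtain ⟨u, w, -, huw⟩ := Set.ncard_eq_two.1 (hG ⟨x, hx⟩)
    have mem : ∀ t, G.Adj f t → t = u ∨ t = w := fun t ht => by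
      have : t ∈ G.neighborSet f := ht
      simpa [huw] using this
    have hzy : z = y := by
      have h1 := mem z h.1
      have h2 := mem x hx
      have h3 := mem y hy
      grind
    subst hzy
    exact walk q hp.2

theorem reflTransGen_of_isChain {R : V → V → Prop} (hR : ∀ a b, R a b → R b a) {l : List V}
    (hl : l.IsChain R) {a b : V} (ha : a ∈ l) (hb : b ∈ l) : Relation.ReflTransGen R a b := by
  have hs : Std.Symm R := ⟨hR⟩
  have key : ∀ (l : List V) (c : V), (c :: l).IsChain R →
      ∀ x ∈ c :: l, Relation.ReflTransGen R c x := by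
    intro l
    induction l with
    | nil => intro c _ x hx; rw [List.mem_singleton.1 hx]
    | cons d l ih =>
      intro c hc x hx
      rw [List.isChain_cons_cons] at hc
      rcases List.mem_cons.1 hx with rfl | hx
      · exact .refl
      · exact .head hc.1 (ih d hc.2 x hx)
  cases l with
  | nil => cases ha
  | cons c l =>
    refine .trans ?_ (key l c hl b hb)
    have := key l c hl a ha
    exact Std.Symm.symm _ _ this

end Connectivity

/-- Two faces of `F` at the vertex `v` that share an edge. -/
def LinkAdj (F : Finset (Finset ℕ)) (v : ℕ) (f g : Finset ℕ) : Prop :=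
  f ∈ F ∧ g ∈ F ∧ v ∈ f ∧ v ∈ g ∧ (f ∩ g).card = 2

/-- Two faces of `F` that share an edge. -/
def FaceAdj (F : Finset (Finset ℕ)) (f g : Finset ℕ) : Prop :=
  f ∈ F ∧ g ∈ F ∧ (f ∩ g).card = 2

theorem LinkAdj.symm {F : Finset (Finset ℕ)} {v : ℕ} {f g : Finset ℕ} (h : LinkAdj F v f g) :
    LinkAdj F v g f :=
  ⟨h.2.1, h.1, h.2.2.2.1, h.2.2.1, by rw [Finset.inter_comm]; exact h.2.2.2.2⟩

theorem FaceAdj.symm {F : Finset (Finset ℕ)} {f g : Finset ℕ} (h : FaceAdj F f g) :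
    FaceAdj F g f :=
  ⟨h.2.1, h.1, by rw [Finset.inter_comm]; exact h.2.2⟩

theorem LinkAdj.mono {F F' : Finset (Finset ℕ)} (hF : F ⊆ F') {v : ℕ} {f g : Finset ℕ}
    (h : LinkAdj F v f g) : LinkAdj F' v f g :=
  ⟨hF h.1, hF h.2.1, h.2.2⟩

theorem FaceAdj.mono {F F' : Finset (Finset ℕ)} (hF : F ⊆ F') {f g : Finset ℕ}
    (h : FaceAdj F f g) : FaceAdj F' f g :=
  ⟨hF h.1, hF h.2.1, h.2.2⟩

theorem LinkAdj.faceAdj {F : Finset (Finset ℕ)} {v : ℕ} {f g : Finset ℕ}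
    (h : LinkAdj F v f g) : FaceAdj F f g :=
  ⟨h.1, h.2.1, h.2.2.2.2⟩

theorem reflTransGen_symm {α : Type*} {R : α → α → Prop} (hR : ∀ a b, R a b → R b a) {a b : α}
    (h : Relation.ReflTransGen R a b) : Relation.ReflTransGen R b a := by
  have hs : Std.Symm R := ⟨hR⟩
  exact Std.Symm.symm _ _ h

theorem inter_eq_of_card {f g e : Finset ℕ} (hf : f.card = 3) (hg : g.card = 3) (hfg : f ≠ g)
    (hef : e ⊆ f) (heg : e ⊆ g) (he : e.card = 2) : f ∩ g = e := by
  symm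
  apply Finset.eq_of_subset_of_card_le (Finset.subset_inter hef heg)
  rw [he]
  by_contra! h
  have h1 : f ∩ g = f := Finset.eq_of_subset_of_card_le Finset.inter_subset_left (by omega)
  have h2 : f ∩ g = g := Finset.eq_of_subset_of_card_le Finset.inter_subset_right (by omega)
  exact hfg (h1.symm.trans h2)

theorem mem_vertsOf {F : Finset (Finset ℕ)} {v : ℕ} : v ∈ vertsOf F ↔ ∃ f ∈ F, v ∈ f := by
  simp [vertsOf, Finset.mem_sup]

theorem mem_edgesOf {F : Finset (Finset ℕ)} {e : Finset ℕ} :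
    e ∈ edgesOf F ↔ e.card = 2 ∧ ∃ f ∈ F, e ⊆ f := by
  simp only [edgesOf, Finset.mem_filter, Finset.mem_powersetCard]
  refine ⟨fun h => ⟨h.1.2, h.2⟩, fun h => ⟨⟨?_, h.1⟩, h.2⟩⟩
  obtain ⟨-, f, hf, hef⟩ := h
  exact fun x hx => mem_vertsOf.2 ⟨f, hf, hef hx⟩

variable (T : Triangulation)

theorem mem_triangles {t : Finset ℕ} :
    t ∈ T.triangles ↔ t.card = 3 ∧ ∀ e ⊆ t, e.card = 2 → e ∈ T.edges := by
  simp only [triangles, Finset.mem_filter, Finset.mem_powersetCard]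
  refine ⟨fun h => ⟨h.1.2, fun e he hc => h.2 e ⟨he, hc⟩⟩,
    fun h => ⟨⟨fun x hx => ?_, h.1⟩, fun e he => h.2 e he.1 he.2⟩⟩
  obtain ⟨e, hxe, het, hc⟩ := Finset.exists_subsuperset_card_eq
    (Finset.singleton_subset_iff.2 hx) (n := 2) (by simp) (by omega)
  obtain ⟨-, f, hf, hef⟩ := mem_edgesOf.1 (h.2 e het hc)
  exact mem_vertsOf.2 ⟨f, hf, hef (Finset.singleton_subset_iff.1 hxe)⟩

theorem mem_triangles_of_mem_faces {f : Finset ℕ} (hf : f ∈ T.faces) : f ∈ T.triangles :=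
  T.mem_triangles.2 ⟨T.card_eq_three f hf, fun _ he hc => mem_edgesOf.2 ⟨hc, f, hf, he⟩⟩

theorem subset_verts {f : Finset ℕ} (hf : f ∈ T.faces) : f ⊆ T.verts :=
  fun _ hx => mem_vertsOf.2 ⟨f, hf, hx⟩

/-- Across each edge of a face there is exactly one other face. -/
theorem exists_other_face {f e : Finset ℕ} (hf : f ∈ T.faces) (he : e ⊆ f) (hc : e.card = 2) :
    ∃ g ∈ T.faces, g ≠ f ∧ e ⊆ g ∧ ∀ k ∈ T.faces, e ⊆ k → k = f ∨ k = g := by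
  obtain ⟨x, y, hxy, h⟩ := Finset.card_eq_two.1 (T.edge_in_two_faces e hc ⟨f, hf, he⟩)
  have mem : ∀ k, (k ∈ T.faces ∧ e ⊆ k) ↔ k = x ∨ k = y := fun k => by
    have := Finset.ext_iff.1 h k
    simpa using this
  have hx := (mem x).2 (Or.inl rfl)
  have hy := (mem y).2 (Or.inr rfl)
  rcases (mem f).1 ⟨hf, he⟩ with rfl | rfl
  · exact ⟨y, hy.1, hxy.symm, hy.2, fun k hk hek => (mem k).1 ⟨hk, hek⟩⟩
  · exact ⟨x, hx.1, hxy, hx.2, fun k hk hek => ((mem k).1 ⟨hk, hek⟩).symm⟩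

/-- The graph of faces around a vertex, adjacent when they share an edge. -/
def linkGraph (v : ℕ) : SimpleGraph {f // f ∈ T.faces ∧ v ∈ f} where
  Adj f g := (f.1 ∩ g.1).card = 2
  symm := ⟨fun f g h => by rw [Finset.inter_comm]; exact h⟩
  loopless := ⟨fun f h => by
    have := T.card_eq_three f.1 f.2.1
    rw [Finset.inter_self] at h
    omega⟩

theorem linkGraph_isCycles (v : ℕ) : (T.linkGraph v).IsCycles := by
  rintro ⟨f, hf, hv⟩ -
  obtain ⟨a, b, hab, hfab⟩ : ∃ a b, a ≠ b ∧ f.erase v = {a, b} := by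
    rw [← Finset.card_eq_two, Finset.card_erase_of_mem hv, T.card_eq_three f hf]
  have hf3 := T.card_eq_three f hf
  have ha : a ∈ f.erase v := by simp [hfab]
  have hb : b ∈ f.erase v := by simp [hfab]
  rw [Finset.mem_erase] at ha hb
  have hfe : f = {v, a, b} := by rw [← hfab, Finset.insert_erase hv]
  obtain ⟨g, hg, hgf, hag, hgu⟩ := T.exists_other_face (e := {v, a}) hf
    (by simp [Finset.insert_subset_iff, hv, ha.2]) (Finset.card_pair ha.1.symm)
  obtain ⟨k, hk, hkf, hbk, hku⟩ := T.exists_other_face (e := {v, b}) hf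
    (by simp [Finset.insert_subset_iff, hv, hb.2]) (Finset.card_pair hb.1.symm)
  have hgk : g ≠ k := by
    rintro rfl
    refine hgf (Finset.eq_of_subset_of_card_le ?_ ?_).symm
    · rw [hfe]
      simp only [Finset.insert_subset_iff, Finset.singleton_subset_iff] at hag hbk ⊢
      exact ⟨hag.1, hag.2, hbk.2⟩
    · rw [hf3, T.card_eq_three g hg]
  rw [Set.ncard_eq_two]
  refine ⟨⟨g, hg, hag (by simp)⟩, ⟨k, hk, hbk (by simp)⟩, by simpa using hgk, ?_⟩
  ext ⟨l, hl, hvl⟩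
  simp only [SimpleGraph.mem_neighborSet, Set.mem_insert_iff, Set.mem_singleton_iff,
    Subtype.mk.injEq]
  change (f ∩ l).card = 2 ↔ _
  constructor
  · intro hc
    have hlf : l ≠ f := by rintro rfl; simp at hc; omega
    have : ∃ x ∈ f ∩ l, x ≠ v := Finset.exists_mem_ne (by omega) v
    obtain ⟨x, hx, hxv⟩ := this
    rw [Finset.mem_inter] at hx
    have hx' : x = a ∨ x = b := by
      have := hx.1
      rw [hfe] at this
      simpa [hxv] using this
    rcases hx' with rfl | rfl
    · left
      exact (hgu l hl (by simp [Finset.insert_subset_iff, hvl, hx.2])).resolve_left hlf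
    · right
      exact (hku l hl (by simp [Finset.insert_subset_iff, hvl, hx.2])).resolve_left hlf
  · rintro (rfl | rfl)
    · rw [inter_eq_of_card hf3 (T.card_eq_three l hl) hgf.symm _ hag (Finset.card_pair ha.1.symm),
        Finset.card_pair ha.1.symm]
      simp [Finset.insert_subset_iff, hv, ha.2]
    · rw [inter_eq_of_card hf3 (T.card_eq_three l hl) hkf.symm _ hbk (Finset.card_pair hb.1.symm),
        Finset.card_pair hb.1.symm]
      simp [Finset.insert_subset_iff, hv, hb.2]

/-- The two neighbours of a face at a vertex remain connected around that vertex after the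
face has been removed. -/
theorem link_avoid_adj {v : ℕ} {f h k : Finset ℕ} (hh : LinkAdj T.faces v f h)
    (hk : LinkAdj T.faces v f k) : Relation.ReflTransGen (LinkAdj (T.faces.erase f) v) h k := by
  have hfin : Finite {f // f ∈ T.faces ∧ v ∈ f} :=
    (T.faces.finite_toSet.subset fun _ h => h.1).to_subtype
  have := reflTransGen_avoid_of_isCycles (T.linkGraph_isCycles v)
    (f := ⟨f, hh.1, hh.2.2.1⟩) (x := ⟨k, hk.2.1, hk.2.2.2.1⟩) (y := ⟨h, hh.2.1, hh.2.2.2.1⟩)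
    hk.2.2.2.2 hh.2.2.2.2
  refine this.lift (fun x => x.1) ?_
  rintro ⟨x, hx, hvx⟩ ⟨y, hy, hvy⟩ ⟨hadj, hxf, hyf⟩
  simp only [ne_eq, Subtype.mk.injEq] at hxf hyf
  exact ⟨Finset.mem_erase.2 ⟨hxf, hx⟩, Finset.mem_erase.2 ⟨hyf, hy⟩, hvx, hvy, hadj⟩

/-- If the neighbours of `f` stay connected to each other when `f` is removed, then removing `f`
does not disconnect anything. -/
theorem reflTransGen_avoid {α : Type*} {R R' : α → α → Prop} {f : α}
    (hRR' : ∀ a b, R a b → a ≠ f → b ≠ f → R' a b) (hsymm : ∀ a b, R a b → R b a)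
    (hf : ∀ a b, R f a → R f b → Relation.ReflTransGen R' a b) {h k : α}
    (hhk : Relation.ReflTransGen R h k) (hhf : h ≠ f) (hkf : k ≠ f) :
    Relation.ReflTransGen R' h k := by
  suffices (k ≠ f → Relation.ReflTransGen R' h k) ∧
      (k = f → ∀ a, R f a → Relation.ReflTransGen R' h a) from this.1 hkf
  clear hkf
  induction hhk with
  | refl => exact ⟨fun _ => .refl, fun h => absurd h hhf⟩
  | @tail k l _ hkl ih =>
    by_cases hk : k = f
    · subst hk
      exact ⟨fun _ => ih.2 rfl l hkl, fun _ => ih.2 rfl⟩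
    · refine ⟨fun hl => (ih.1 hk).tail (hRR' _ _ hkl hk hl), ?_⟩
      rintro rfl a ha
      exact (ih.1 hk).trans (hf _ _ (hsymm _ _ hkl) ha)

theorem link_connected_erase {v : ℕ} {f h k : Finset ℕ} (hh : h ∈ T.faces.erase f)
    (hk : k ∈ T.faces.erase f) (hvh : v ∈ h) (hvk : v ∈ k) :
    Relation.ReflTransGen (LinkAdj (T.faces.erase f) v) h k := by
  rw [Finset.mem_erase] at hh hk
  refine reflTransGen_avoid (R := LinkAdj T.faces v) (f := f) ?_ (fun _ _ h => h.symm)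
    (fun _ _ h k => T.link_avoid_adj h k) (T.link_connected v h hh.2 k hk.2 hvh hvk) hh.1 hk.1
  exact fun a b h ha hb => ⟨Finset.mem_erase.2 ⟨ha, h.1⟩, Finset.mem_erase.2 ⟨hb, h.2.1⟩, h.2.2⟩

theorem face_connected_erase {f h k : Finset ℕ} (hh : h ∈ T.faces.erase f)
    (hk : k ∈ T.faces.erase f) :
    Relation.ReflTransGen (FaceAdj (T.faces.erase f)) h k := by
  rw [Finset.mem_erase] at hh hk
  refine reflTransGen_avoid (R := FaceAdj T.faces) (f := f) ?_ (fun _ _ h => h.symm) ?_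
    (T.face_connected h hh.2 k hk.2) hh.1 hk.1
  · exact fun a b h ha hb =>
      ⟨Finset.mem_erase.2 ⟨ha, h.1⟩, Finset.mem_erase.2 ⟨hb, h.2.1⟩, h.2.2⟩
  · rintro a b ⟨hf, ha, hfa⟩ ⟨-, hb, hfb⟩
    have hf3 := T.card_eq_three f hf
    have hne : ((f ∩ a) ∩ (f ∩ b)).Nonempty := by
      rw [← Finset.card_pos]
      have h1 := Finset.card_union_add_card_inter (f ∩ a) (f ∩ b)
      have h2 : ((f ∩ a) ∪ (f ∩ b)).card ≤ f.card := Finset.card_le_card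
        (Finset.union_subset Finset.inter_subset_left Finset.inter_subset_left)
      omega
    obtain ⟨v, hv⟩ := hne
    simp only [Finset.mem_inter] at hv
    exact Relation.ReflTransGen.mono (fun _ _ h => h.faceAdj) _ _
      (T.link_avoid_adj ⟨hf, ha, hv.1.1, hv.1.2, hfa⟩ ⟨hf, hb, hv.1.1, hv.2.2, hfb⟩)

/-- `T` and `P` meet exactly in a common face `f`. -/
structure MeetAt (T P : Triangulation) (f : Finset ℕ) : Prop where
  left : f ∈ T.faces
  right : f ∈ P.faces
  verts : T.verts ∩ P.verts = f

namespace MeetAt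

variable {T} {P : Triangulation} {f : Finset ℕ}

theorem symm (h : MeetAt T P f) : MeetAt P T f :=
  ⟨h.right, h.left, by rw [Finset.inter_comm]; exact h.verts⟩

theorem subset (h : MeetAt T P f) {e s t : Finset ℕ} (hs : s ∈ T.faces) (ht : t ∈ P.faces)
    (hes : e ⊆ s) (het : e ⊆ t) : e ⊆ f := by
  rw [← h.verts]
  exact Finset.subset_inter (hes.trans (T.subset_verts hs)) (het.trans (P.subset_verts ht))

theorem eq (h : MeetAt T P f) {s : Finset ℕ} (hs : s ∈ T.faces) (ht : s ∈ P.faces) : s = f :=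
  Finset.eq_of_subset_of_card_le (h.subset hs ht subset_rfl subset_rfl)
    (by rw [T.card_eq_three s hs, T.card_eq_three f h.left])

theorem ne (h : MeetAt T P f) {s t : Finset ℕ} (hs : s ∈ T.faces) (ht : t ∈ P.faces)
    (hsf : s ≠ f) : s ≠ t := by
  rintro rfl
  exact hsf (h.eq hs ht)

theorem card_filter (h : MeetAt T P f) {e g : Finset ℕ} (he : e.card = 2)
    (hg : g ∈ T.faces) (heg : e ⊆ g) :
    (((T.faces ∪ P.faces).erase f).filter (fun g => e ⊆ g)).card = 2 := by
  by_cases hef : e ⊆ f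
  · obtain ⟨s, hs, hsf, hes, hsu⟩ := T.exists_other_face h.left hef he
    obtain ⟨t, ht, htf, het, htu⟩ := P.exists_other_face h.right hef he
    rw [Finset.card_eq_two]
    refine ⟨s, t, h.ne hs ht hsf, ?_⟩
    ext k
    simp only [Finset.mem_filter, Finset.mem_erase, Finset.mem_union, Finset.mem_insert,
      Finset.mem_singleton]
    constructor
    · rintro ⟨⟨hkf, hk | hk⟩, hek⟩
      · exact Or.inl ((hsu k hk hek).resolve_left hkf)
      · exact Or.inr ((htu k hk hek).resolve_left hkf)
    · rintro (rfl | rfl)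
      · exact ⟨⟨hsf, Or.inl hs⟩, hes⟩
      · exact ⟨⟨htf, Or.inr ht⟩, het⟩
  · rw [← T.edge_in_two_faces e he ⟨g, hg, heg⟩]
    congr 1
    ext k
    simp only [Finset.mem_filter, Finset.mem_erase, Finset.mem_union]
    constructor
    · rintro ⟨⟨-, hk | hk⟩, hek⟩
      · exact ⟨hk, hek⟩
      · exact absurd (h.subset hg hk heg hek) hef
    · rintro ⟨hk, hek⟩
      refine ⟨⟨?_, Or.inl hk⟩, hek⟩
      rintro rfl
      exact hef hek

theorem exists_adj (h : MeetAt T P f) {v : ℕ} (hv : v ∈ f) :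
    ∃ s ∈ T.faces.erase f, ∃ t ∈ P.faces.erase f, v ∈ s ∧ v ∈ t ∧ (s ∩ t).card = 2 := by
  obtain ⟨e, hve, hef, he⟩ := Finset.exists_subsuperset_card_eq
    (Finset.singleton_subset_iff.2 hv) (n := 2) (by simp) (by rw [T.card_eq_three f h.left]; simp)
  rw [Finset.singleton_subset_iff] at hve
  obtain ⟨s, hs, hsf, hes, -⟩ := T.exists_other_face h.left hef he
  obtain ⟨t, ht, htf, het, -⟩ := P.exists_other_face h.right hef he
  refine ⟨s, Finset.mem_erase.2 ⟨hsf, hs⟩, t, Finset.mem_erase.2 ⟨htf, ht⟩, hes hve, het hve, ?_⟩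
  rw [inter_eq_of_card (T.card_eq_three s hs) (P.card_eq_three t ht) (h.ne hs ht hsf) hes het he,
    he]

theorem erase_subset_left : T.faces.erase f ⊆ (T.faces ∪ P.faces).erase f :=
  Finset.erase_subset_erase f Finset.subset_union_left

theorem erase_subset_right : P.faces.erase f ⊆ (T.faces ∪ P.faces).erase f :=
  Finset.erase_subset_erase f Finset.subset_union_right

theorem mem_erase_union {s : Finset ℕ} (hs : s ∈ (T.faces ∪ P.faces).erase f) :
    s ∈ T.faces.erase f ∨ s ∈ P.faces.erase f := by
  simp only [Finset.mem_erase, Finset.mem_union] at hs ⊢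
  tauto

theorem link_connected_left {v : ℕ} {s t : Finset ℕ} (hs : s ∈ T.faces.erase f)
    (ht : t ∈ T.faces.erase f) (hvs : v ∈ s) (hvt : v ∈ t) :
    Relation.ReflTransGen (LinkAdj ((T.faces ∪ P.faces).erase f) v) s t :=
  Relation.ReflTransGen.mono (fun _ _ h => h.mono erase_subset_left) _ _
    (T.link_connected_erase hs ht hvs hvt)

theorem link_connected_right {v : ℕ} {s t : Finset ℕ} (hs : s ∈ P.faces.erase f)
    (ht : t ∈ P.faces.erase f) (hvs : v ∈ s) (hvt : v ∈ t) :
    Relation.ReflTransGen (LinkAdj ((T.faces ∪ P.faces).erase f) v) s t :=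
  Relation.ReflTransGen.mono (fun _ _ h => h.mono erase_subset_right) _ _
    (P.link_connected_erase hs ht hvs hvt)

theorem link_connected_left_right (h : MeetAt T P f) {v : ℕ} {s t : Finset ℕ}
    (hs : s ∈ T.faces.erase f) (ht : t ∈ P.faces.erase f) (hvs : v ∈ s) (hvt : v ∈ t) :
    Relation.ReflTransGen (LinkAdj ((T.faces ∪ P.faces).erase f) v) s t := by
  have hv : v ∈ f := Finset.singleton_subset_iff.1 (h.subset (Finset.mem_of_mem_erase hs)
    (Finset.mem_of_mem_erase ht) (Finset.singleton_subset_iff.2 hvs)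
    (Finset.singleton_subset_iff.2 hvt))
  obtain ⟨s', hs', t', ht', hvs', hvt', hc⟩ := h.exists_adj hv
  exact ((link_connected_left hs hs' hvs hvs').tail
    ⟨erase_subset_left hs', erase_subset_right ht', hvs', hvt', hc⟩).trans
    (link_connected_right ht' ht hvt' hvt)

theorem face_connected_left {s t : Finset ℕ} (hs : s ∈ T.faces.erase f)
    (ht : t ∈ T.faces.erase f) :
    Relation.ReflTransGen (FaceAdj ((T.faces ∪ P.faces).erase f)) s t :=
  Relation.ReflTransGen.mono (fun _ _ h => h.mono erase_subset_left) _ _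
    (T.face_connected_erase hs ht)

theorem face_connected_right {s t : Finset ℕ} (hs : s ∈ P.faces.erase f)
    (ht : t ∈ P.faces.erase f) :
    Relation.ReflTransGen (FaceAdj ((T.faces ∪ P.faces).erase f)) s t :=
  Relation.ReflTransGen.mono (fun _ _ h => h.mono erase_subset_right) _ _
    (P.face_connected_erase hs ht)

theorem face_connected_left_right (h : MeetAt T P f) {s t : Finset ℕ}
    (hs : s ∈ T.faces.erase f) (ht : t ∈ P.faces.erase f) :
    Relation.ReflTransGen (FaceAdj ((T.faces ∪ P.faces).erase f)) s t := by
  obtain ⟨v, hv⟩ : f.Nonempty := by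
    rw [← Finset.card_pos, T.card_eq_three f h.left]; norm_num
  obtain ⟨s', hs', t', ht', -, -, hc⟩ := h.exists_adj hv
  exact ((face_connected_left hs hs').tail
    ⟨erase_subset_left hs', erase_subset_right ht', hc⟩).trans (face_connected_right ht' ht)

/-- The connected sum of two triangulations along a common face. -/
def glue (h : MeetAt T P f) : Triangulation where
  faces := (T.faces ∪ P.faces).erase f
  faces_nonempty := by
    obtain ⟨v, hv⟩ : f.Nonempty := by
      rw [← Finset.card_pos, T.card_eq_three f h.left]; norm_num
    obtain ⟨s, hs, -⟩ := h.exists_adj hv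
    exact ⟨s, erase_subset_left hs⟩
  card_eq_three g hg := by
    rcases Finset.mem_union.1 (Finset.mem_of_mem_erase hg) with hg | hg
    · exact T.card_eq_three g hg
    · exact P.card_eq_three g hg
  edge_in_two_faces e he := by
    rintro ⟨g, hg, heg⟩
    rcases Finset.mem_union.1 (Finset.mem_of_mem_erase hg) with hg | hg
    · exact h.card_filter he hg heg
    · rw [Finset.union_comm]
      exact h.symm.card_filter he hg heg
  link_connected v s hs t ht hvs hvt := by
    rcases mem_erase_union hs with hs | hs <;> rcases mem_erase_union ht with ht | ht
    · exact link_connected_left hs ht hvs hvt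
    · exact h.link_connected_left_right hs ht hvs hvt
    · exact reflTransGen_symm (fun _ _ h => LinkAdj.symm h) (h.link_connected_left_right ht hs hvt hvs)
    · exact link_connected_right hs ht hvs hvt
  face_connected s hs t ht := by
    rcases mem_erase_union hs with hs | hs <;> rcases mem_erase_union ht with ht | ht
    · exact face_connected_left hs ht
    · exact h.face_connected_left_right hs ht
    · exact reflTransGen_symm (fun _ _ h => FaceAdj.symm h) (h.face_connected_left_right ht hs)
    · exact face_connected_right hs ht

theorem mem_glue_faces (h : MeetAt T P f) {s : Finset ℕ} :
    s ∈ h.glue.faces ↔ s ≠ f ∧ (s ∈ T.faces ∨ s ∈ P.faces) := by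
  simp [glue]

theorem edges_left_subset (h : MeetAt T P f) : T.edges ⊆ h.glue.edges := by
  intro e he
  obtain ⟨hc, g, hg, heg⟩ := mem_edgesOf.1 he
  obtain ⟨k, hk, hkg, hek, -⟩ := T.exists_other_face hg heg hc
  rcases eq_or_ne g f with rfl | hgf
  · exact mem_edgesOf.2 ⟨hc, k, h.mem_glue_faces.2 ⟨hkg, Or.inl hk⟩, hek⟩
  · exact mem_edgesOf.2 ⟨hc, g, h.mem_glue_faces.2 ⟨hgf, Or.inl hg⟩, heg⟩

theorem glue_symm (h : MeetAt T P f) : h.symm.glue = h.glue := by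
  simp only [glue, Finset.union_comm]

theorem edges_right_subset (h : MeetAt T P f) : P.edges ⊆ h.glue.edges := by
  rw [← h.glue_symm]
  exact h.symm.edges_left_subset

theorem glue_edges (h : MeetAt T P f) : h.glue.edges = T.edges ∪ P.edges := by
  refine (Finset.union_subset h.edges_left_subset h.edges_right_subset).antisymm' ?_
  intro e he
  obtain ⟨hc, g, hg, heg⟩ := mem_edgesOf.1 he
  rw [Finset.mem_union]
  exact (h.mem_glue_faces.1 hg).2.imp (fun hg => mem_edgesOf.2 ⟨hc, g, hg, heg⟩)
    fun hg => mem_edgesOf.2 ⟨hc, g, hg, heg⟩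

theorem glue_verts (h : MeetAt T P f) : h.glue.verts = T.verts ∪ P.verts := by
  ext v
  rw [Finset.mem_union]
  constructor
  · intro hv
    obtain ⟨g, hg, hvg⟩ := mem_vertsOf.1 hv
    exact (h.mem_glue_faces.1 hg).2.imp (fun hg => T.subset_verts hg hvg)
      fun hg => P.subset_verts hg hvg
  · have key : ∀ {s}, s ∈ T.faces ∨ s ∈ P.faces → v ∈ s → v ∈ h.glue.verts := by
      intro s hs hvs
      rcases eq_or_ne s f with rfl | hsf
      · obtain ⟨s', hs', -, -, hv, -⟩ := h.exists_adj hvs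
        exact mem_vertsOf.2 ⟨s', erase_subset_left hs', hv⟩
      · exact mem_vertsOf.2 ⟨s, h.mem_glue_faces.2 ⟨hsf, hs⟩, hvs⟩
    rintro (hv | hv)
    · obtain ⟨g, hg, hvg⟩ := mem_vertsOf.1 hv
      exact key (Or.inl hg) hvg
    · obtain ⟨g, hg, hvg⟩ := mem_vertsOf.1 hv
      exact key (Or.inr hg) hvg

theorem card_glue_verts (h : MeetAt T P f) :
    h.glue.verts.card + 3 = T.verts.card + P.verts.card := by
  rw [h.glue_verts, ← Finset.card_union_add_card_inter, h.verts, T.card_eq_three f h.left]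

theorem edges_inter (h : MeetAt T P f) : T.edges ∩ P.edges = f.powersetCard 2 := by
  ext e
  rw [Finset.mem_inter, Finset.mem_powersetCard]
  constructor
  · rintro ⟨h1, h2⟩
    obtain ⟨hc, s, hs, hes⟩ := mem_edgesOf.1 h1
    obtain ⟨-, t, ht, het⟩ := mem_edgesOf.1 h2
    exact ⟨h.subset hs ht hes het, hc⟩
  · rintro ⟨hef, hc⟩
    exact ⟨mem_edgesOf.2 ⟨hc, f, h.left, hef⟩, mem_edgesOf.2 ⟨hc, f, h.right, hef⟩⟩

theorem glue_euler (h : MeetAt T P f) : h.glue.euler = T.euler + P.euler - 2 := by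
  have hv := h.card_glue_verts
  have he : h.glue.edges.card + 3 = T.edges.card + P.edges.card := by
    rw [h.glue_edges, ← Finset.card_union_add_card_inter, h.edges_inter,
      Finset.card_powersetCard, T.card_eq_three f h.left]
    rfl
  have hf : h.glue.faces.card + 2 = T.faces.card + P.faces.card := by
    have hi : T.faces ∩ P.faces = {f} := by
      ext s
      simp only [Finset.mem_inter, Finset.mem_singleton]
      exact ⟨fun hs => h.eq hs.1 hs.2, by rintro rfl; exact ⟨h.left, h.right⟩⟩
    rw [← Finset.card_union_add_card_inter, hi, Finset.card_singleton,
      ← Finset.card_erase_add_one (Finset.mem_union_left P.faces h.left)]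
    rfl
  unfold euler
  omega

end MeetAt

/-- The same triangle with the opposite orientation. -/
def flipTriple (t : ℕ × ℕ × ℕ) : ℕ × ℕ × ℕ := (t.1, t.2.2, t.2.1)

theorem mem_dedges_flipTriple {t : ℕ × ℕ × ℕ} {a b : ℕ} :
    (a, b) ∈ dedges (flipTriple t) ↔ (b, a) ∈ dedges t := by
  simp only [dedges, flipTriple, Finset.mem_insert, Finset.mem_singleton, Prod.mk.injEq]
  tauto

theorem IsCoherent.flip {F : Finset (Finset ℕ)} {σ : Finset ℕ → ℕ × ℕ × ℕ}
    (h : IsCoherent F σ) : IsCoherent F (fun f => flipTriple (σ f)) := by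
  refine ⟨fun f hf => ?_, fun f hf g hg hfg => ?_⟩
  · conv_rhs => rw [← h.1 f hf]
    simp only [flipTriple]
    rw [Finset.pair_comm]
  · rw [Finset.disjoint_left]
    rintro ⟨a, b⟩ h1 h2
    rw [mem_dedges_flipTriple] at h1 h2
    exact Finset.disjoint_left.1 (h.2 f hf g hg hfg) h1 h2

theorem mem_of_mem_dedges {t : ℕ × ℕ × ℕ} {a b : ℕ} (h : (a, b) ∈ dedges t) :
    a ∈ ({t.1, t.2.1, t.2.2} : Finset ℕ) ∧ b ∈ ({t.1, t.2.1, t.2.2} : Finset ℕ) := by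
  simp only [dedges, Finset.mem_insert, Finset.mem_singleton, Prod.mk.injEq] at h ⊢
  tauto

theorem mem_dedges_or {t : ℕ × ℕ × ℕ} {a b : ℕ} (hab : a ≠ b)
    (ha : a ∈ ({t.1, t.2.1, t.2.2} : Finset ℕ)) (hb : b ∈ ({t.1, t.2.1, t.2.2} : Finset ℕ)) :
    (a, b) ∈ dedges t ∨ (b, a) ∈ dedges t := by
  simp only [dedges, Finset.mem_insert, Finset.mem_singleton, Prod.mk.injEq] at ha hb ⊢
  grind

theorem ne_of_card_triple {a b c : ℕ} (h : ({a, b, c} : Finset ℕ).card = 3) :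
    a ≠ b ∧ a ≠ c ∧ b ≠ c := by
  have key : ∀ x y : ℕ, ({a, b, c} : Finset ℕ) ≠ {x, y} := fun x y hxy => by
    have := Finset.card_le_two (a := x) (b := y)
    rw [← hxy] at this
    omega
  refine ⟨?_, ?_, ?_⟩ <;> rintro rfl
  · exact key a c (by simp)
  · exact key b a (by ext; simp)
  · exact key a b (by simp)

/-- Two orientations of a triangle either agree or are opposite. -/
theorem dedges_eq_or {s t : ℕ × ℕ × ℕ}
    (hs : ({s.1, s.2.1, s.2.2} : Finset ℕ).card = 3)
    (h : ({s.1, s.2.1, s.2.2} : Finset ℕ) = {t.1, t.2.1, t.2.2}) :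
    dedges s = dedges t ∨ dedges s = dedges (flipTriple t) := by
  obtain ⟨a, b, c⟩ := s
  obtain ⟨x, y, z⟩ := t
  have ht : ({x, y, z} : Finset ℕ).card = 3 := h ▸ hs
  simp only at hs h
  have h1 := ne_of_card_triple hs
  have h2 := ne_of_card_triple ht
  have ha : a ∈ ({x, y, z} : Finset ℕ) := by simp [← h]
  have hb : b ∈ ({x, y, z} : Finset ℕ) := by simp [← h]
  have hc : c ∈ ({x, y, z} : Finset ℕ) := by simp [← h]
  simp only [Finset.mem_insert, Finset.mem_singleton] at ha hb hc
  have hrot : ∀ p q r : ℕ × ℕ, ({p, q, r} : Finset (ℕ × ℕ)) = {q, r, p} := by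
    intro p q r
    rw [Finset.insert_comm, Finset.pair_comm p r]
  clear hs h ht
  simp only [dedges, flipTriple]
  rcases ha with rfl | rfl | rfl <;> rcases hb with rfl | rfl | rfl <;>
    first
    | exact absurd rfl h1.1
    | (rcases hc with rfl | rfl | rfl <;>
        first
        | exact absurd rfl h1.2.1
        | exact absurd rfl h1.2.2
        | exact Or.inl rfl
        | exact Or.inl (hrot _ _ _)
        | exact Or.inl (hrot _ _ _).symm
        | exact Or.inr rfl
        | exact Or.inr (hrot _ _ _)
        | exact Or.inr (hrot _ _ _).symm)

/-- A directed edge inside `f` used by a face other than `f` is traversed backwards by `f`. -/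
theorem IsCoherent.swap_mem_dedges {F : Finset (Finset ℕ)} {σ : Finset ℕ → ℕ × ℕ × ℕ}
    (h : IsCoherent F σ) {f s : Finset ℕ} (hf : f ∈ F) (hs : s ∈ F) (hsf : s ≠ f) {a b : ℕ}
    (hab : a ≠ b) (ha : a ∈ f) (hb : b ∈ f) (hd : (a, b) ∈ dedges (σ s)) :
    (b, a) ∈ dedges (σ f) := by
  rw [← h.1 f hf] at ha hb
  exact (mem_dedges_or hab ha hb).resolve_left
    (Finset.disjoint_left.1 (h.2 s hs f hf hsf) hd)

theorem ne_of_mem_dedges {t : ℕ × ℕ × ℕ} (ht : ({t.1, t.2.1, t.2.2} : Finset ℕ).card = 3)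
    {a b : ℕ} (h : (a, b) ∈ dedges t) : a ≠ b ∧ (b, a) ∉ dedges t := by
  obtain ⟨x, y, z⟩ := t
  obtain ⟨hxy, hxz, hyz⟩ := ne_of_card_triple ht
  simp only [dedges, Finset.mem_insert, Finset.mem_singleton, Prod.mk.injEq] at h ⊢
  grind

namespace MeetAt

variable {T} {P : Triangulation} {f : Finset ℕ}

theorem glue_coherent (h : MeetAt T P f) {σ τ : Finset ℕ → ℕ × ℕ × ℕ}
    (hσ : IsCoherent T.faces σ) (hτ : IsCoherent P.faces τ)
    (hf : dedges (σ f) = dedges (flipTriple (τ f))) :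
    IsCoherent h.glue.faces (fun g => if g ∈ T.faces then σ g else τ g) := by
  have hP : ∀ {g}, g ∈ P.faces → g ≠ f → g ∉ T.faces := fun hg hgf hgT => hgf (h.eq hgT hg)
  have cross : ∀ {s t}, s ∈ T.faces → s ≠ f → t ∈ P.faces → t ≠ f →
      Disjoint (dedges (σ s)) (dedges (τ t)) := by
    intro s t hs hsf ht htf
    rw [Finset.disjoint_left]
    rintro ⟨a, b⟩ h1 h2
    have m1 := mem_of_mem_dedges h1
    have m2 := mem_of_mem_dedges h2
    rw [hσ.1 s hs] at m1
    rw [hτ.1 t ht] at m2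
    have hsub : ({a, b} : Finset ℕ) ⊆ f := h.subset hs ht
      (by simp [Finset.insert_subset_iff, m1]) (by simp [Finset.insert_subset_iff, m2])
    have ha : a ∈ f := hsub (by simp)
    have hb : b ∈ f := hsub (by simp)
    have hab : a ≠ b := (ne_of_mem_dedges (by rw [hσ.1 s hs, T.card_eq_three s hs]) h1).1
    have k1 := hσ.swap_mem_dedges h.left hs hsf hab ha hb h1
    have k2 := hτ.swap_mem_dedges h.right ht htf hab ha hb h2
    rw [hf, mem_dedges_flipTriple] at k1
    exact (ne_of_mem_dedges (by rw [hτ.1 f h.right, P.card_eq_three f h.right]) k1).2 k2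
  refine ⟨fun g hg => ?_, fun s hs t ht hst => ?_⟩
  · obtain ⟨hgf, hg | hg⟩ := h.mem_glue_faces.1 hg
    · simp only [hg, if_true]
      exact hσ.1 g hg
    · simp only [hP hg hgf, if_false]
      exact hτ.1 g hg
  · obtain ⟨hsf, hs | hs⟩ := h.mem_glue_faces.1 hs <;>
      obtain ⟨htf, ht | ht⟩ := h.mem_glue_faces.1 ht
    · simp only [hs, ht, if_true]
      exact hσ.2 s hs t ht hst
    · simp only [hs, hP ht htf, if_true, if_false]
      exact cross hs hsf ht htf
    · simp only [hP hs hsf, ht, if_true, if_false]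
      exact (cross ht htf hs hsf).symm
    · simp only [hP hs hsf, hP ht htf, if_false]
      exact hτ.2 s hs t ht hst

theorem glue_orientable (h : MeetAt T P f) (hT : T.Orientable) (hP : P.Orientable) :
    h.glue.Orientable := by
  obtain ⟨σ, hσ⟩ := hT
  obtain ⟨τ, hτ⟩ := hP
  rcases dedges_eq_or (s := σ f) (t := τ f) (by rw [hσ.1 f h.left, T.card_eq_three f h.left])
    (by rw [hσ.1 f h.left, hτ.1 f h.right]) with hd | hd
  · exact ⟨_, h.glue_coherent hσ hτ.flip hd⟩
  · exact ⟨_, h.glue_coherent hσ hτ hd⟩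

theorem triangles_left_subset (h : MeetAt T P f) : T.triangles ⊆ h.glue.triangles := by
  intro t ht
  rw [mem_triangles] at ht ⊢
  exact ⟨ht.1, fun e he hc => h.edges_left_subset (ht.2 e he hc)⟩

end MeetAt

/-- Every edge of `T` lies in a nonfacial 3-cycle or in one of the faces in `S`. -/
def IrreducibleUpTo (S : Finset (Finset ℕ)) : Prop :=
  ∀ e ∈ T.edges, (∃ t ∈ T.triangles, t ∉ T.faces ∧ e ⊆ t) ∨ ∃ s ∈ S, e ⊆ s

variable {T} in
theorem IrreducibleUpTo.irreducible (h : T.IrreducibleUpTo ∅) : T.Irreducible := by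
  rintro e ⟨he, hc⟩
  obtain ⟨t, ht, htf, het⟩ := (h e he).resolve_right (by simp)
  obtain ⟨he2, f, hf, hef⟩ := mem_edgesOf.1 he
  have hsub : T.faces.filter (fun f => e ⊆ f) ⊂ T.triangles.filter (fun t => e ⊆ t) := by
    refine ⟨Finset.filter_subset_filter _ fun f hf => T.mem_triangles_of_mem_faces hf, fun hle => ?_⟩
    exact htf (Finset.mem_filter.1 (hle (Finset.mem_filter.2 ⟨ht, het⟩))).1
  have := Finset.card_lt_card hsub
  rw [T.edge_in_two_faces e he2 ⟨f, hf, hef⟩] at this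
  omega

theorem MeetAt.glue_irreducibleUpTo {T P : Triangulation} {f : Finset ℕ} (h : MeetAt T P f)
    {S S' : Finset (Finset ℕ)} (hS : T.IrreducibleUpTo S) (hS' : P.IrreducibleUpTo S') :
    h.glue.IrreducibleUpTo (S.erase f ∪ S'.erase f) := by
  have key : ∀ {T P : Triangulation} (h : MeetAt T P f) {S : Finset (Finset ℕ)},
      T.IrreducibleUpTo S → ∀ e ∈ T.edges,
      (∃ t ∈ h.glue.triangles, t ∉ h.glue.faces ∧ e ⊆ t) ∨ ∃ s ∈ S.erase f, e ⊆ s := by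
    intro T P h S hS e he
    have hf : e ⊆ f → ∃ t ∈ h.glue.triangles, t ∉ h.glue.faces ∧ e ⊆ t := fun hef =>
      ⟨f, h.triangles_left_subset (T.mem_triangles_of_mem_faces h.left),
        fun hfg => (h.mem_glue_faces.1 hfg).1 rfl, hef⟩
    rcases hS e he with ⟨t, ht, htf, het⟩ | ⟨s, hs, hes⟩
    · by_cases htP : t ∈ P.faces
      · have htT : t ⊆ T.verts := by
          simp only [triangles, Finset.mem_filter, Finset.mem_powersetCard] at ht
          exact ht.1.1
        left
        refine hf (het.trans ?_)
        rw [← h.verts]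
        exact Finset.subset_inter htT (P.subset_verts htP)
      · refine Or.inl ⟨t, h.triangles_left_subset ht, fun htg => ?_, het⟩
        exact (h.mem_glue_faces.1 htg).2.elim htf htP
    · by_cases hsf : s = f
      · exact Or.inl (hf (hsf ▸ hes))
      · exact Or.inr ⟨s, Finset.mem_erase.2 ⟨hsf, hs⟩, hes⟩
  intro e he
  rw [h.glue_edges, Finset.mem_union] at he
  rcases he with he | he
  · exact (key h hS e he).imp_right fun ⟨s, hs, hes⟩ => ⟨s, Finset.mem_union_left _ hs, hes⟩
  · have := key h.symm hS' e he
    rw [h.glue_symm] at this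
    exact this.imp_right fun ⟨s, hs, hes⟩ => ⟨s, Finset.mem_union_right _ hs, hes⟩

/-- Relabelling of a set of faces along an injection of the labels. -/
def mapFaces (φ : ℕ ↪ ℕ) (F : Finset (Finset ℕ)) : Finset (Finset ℕ) :=
  F.map (Finset.mapEmbedding φ).toEmbedding

theorem mem_mapFaces {φ : ℕ ↪ ℕ} {F : Finset (Finset ℕ)} {s : Finset ℕ} :
    s ∈ mapFaces φ F ↔ ∃ f ∈ F, f.map φ = s := by
  simp [mapFaces]

theorem map_mem_mapFaces {φ : ℕ ↪ ℕ} {F : Finset (Finset ℕ)} {s : Finset ℕ} :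
    s.map φ ∈ mapFaces φ F ↔ s ∈ F := by
  simp [mapFaces]

theorem exists_map_eq_of_subset {φ : ℕ ↪ ℕ} {e f : Finset ℕ} (h : e ⊆ f.map φ) :
    ∃ e' ⊆ f, e'.map φ = e := by
  obtain ⟨u, hu, rfl⟩ := Finset.subset_map_iff.1 h
  exact ⟨u, hu, rfl⟩

/-- Relabelling of the vertices of a triangulation. -/
def map (φ : ℕ ↪ ℕ) : Triangulation where
  faces := mapFaces φ T.faces
  faces_nonempty := Finset.map_nonempty.2 T.faces_nonempty
  card_eq_three s hs := by
    obtain ⟨f, hf, rfl⟩ := mem_mapFaces.1 hs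
    rw [Finset.card_map, T.card_eq_three f hf]
  edge_in_two_faces e he := by
    rintro ⟨s, hs, hes⟩
    obtain ⟨f, hf, rfl⟩ := mem_mapFaces.1 hs
    obtain ⟨e, hef, rfl⟩ := exists_map_eq_of_subset hes
    rw [Finset.card_map] at he
    rw [← T.edge_in_two_faces e he ⟨f, hf, hef⟩, mapFaces, Finset.filter_map, Finset.card_map]
    congr 1
    ext k
    simp
  link_connected v s hs t ht hvs hvt := by
    obtain ⟨f, hf, rfl⟩ := mem_mapFaces.1 hs
    obtain ⟨g, hg, rfl⟩ := mem_mapFaces.1 ht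
    obtain ⟨v, hvf, rfl⟩ := Finset.mem_map.1 hvs
    rw [Finset.mem_map'] at hvt
    refine (T.link_connected v f hf g hg hvf hvt).lift (Finset.map φ) fun a b hab => ?_
    simp only [Function.onFun]
    rw [map_mem_mapFaces, map_mem_mapFaces, Finset.mem_map', Finset.mem_map', ← Finset.map_inter,
      Finset.card_map]
    exact hab
  face_connected s hs t ht := by
    obtain ⟨f, hf, rfl⟩ := mem_mapFaces.1 hs
    obtain ⟨g, hg, rfl⟩ := mem_mapFaces.1 ht
    refine (T.face_connected f hf g hg).lift (Finset.map φ) fun a b hab => ?_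
    simp only [Function.onFun]
    rw [map_mem_mapFaces, map_mem_mapFaces, ← Finset.map_inter, Finset.card_map]
    exact hab

theorem map_faces (φ : ℕ ↪ ℕ) : (T.map φ).faces = mapFaces φ T.faces := rfl

theorem map_verts (φ : ℕ ↪ ℕ) : (T.map φ).verts = T.verts.map φ := by
  ext v
  simp only [verts, mem_vertsOf, map_faces, mem_mapFaces, Finset.mem_map]
  constructor
  · rintro ⟨_, ⟨f, hf, rfl⟩, hv⟩
    obtain ⟨w, hw, rfl⟩ := Finset.mem_map.1 hv
    exact ⟨w, ⟨f, hf, hw⟩, rfl⟩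
  · rintro ⟨w, ⟨f, hf, hw⟩, rfl⟩
    exact ⟨f.map φ, ⟨f, hf, rfl⟩, Finset.mem_map_of_mem φ hw⟩

theorem map_edges (φ : ℕ ↪ ℕ) : (T.map φ).edges = mapFaces φ T.edges := by
  ext e
  simp only [edges, mem_edgesOf, map_faces, mem_mapFaces]
  constructor
  · rintro ⟨hc, _, ⟨f, hf, rfl⟩, hef⟩
    obtain ⟨e, he, rfl⟩ := exists_map_eq_of_subset hef
    rw [Finset.card_map] at hc
    exact ⟨e, ⟨hc, f, hf, he⟩, rfl⟩
  · rintro ⟨e, ⟨hc, f, hf, he⟩, rfl⟩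
    exact ⟨by rwa [Finset.card_map], f.map φ, ⟨f, hf, rfl⟩, Finset.map_subset_map.2 he⟩

theorem map_euler (φ : ℕ ↪ ℕ) : (T.map φ).euler = T.euler := by
  simp only [euler, map_verts, map_edges, map_faces, mapFaces, Finset.card_map]

variable {T} in
theorem Orientable.map (φ : ℕ ↪ ℕ) (h : T.Orientable) : (T.map φ).Orientable := by
  obtain ⟨σ, hσ⟩ := h
  have hinv : ∀ f : Finset ℕ, Function.invFun (Finset.map φ) (f.map φ) = f :=
    Function.leftInverse_invFun (Finset.map_injective φ)
  let τ : Finset ℕ → ℕ × ℕ × ℕ := fun s =>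
    let t := σ (Function.invFun (Finset.map φ) s)
    (φ t.1, φ t.2.1, φ t.2.2)
  have hd : ∀ f, dedges (τ (f.map φ)) = (dedges (σ f)).map (φ.prodMap φ) := by
    intro f
    simp [τ, hinv, dedges, Prod.map]
  refine ⟨τ, fun s hs => ?_, fun s hs t ht hst => ?_⟩
  · obtain ⟨f, hf, rfl⟩ := mem_mapFaces.1 hs
    conv_rhs => rw [← hσ.1 f hf]
    simp [τ, hinv]
  · obtain ⟨f, hf, rfl⟩ := mem_mapFaces.1 hs
    obtain ⟨g, hg, rfl⟩ := mem_mapFaces.1 ht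
    rw [hd, hd, Finset.disjoint_map]
    exact hσ.2 f hf g hg (fun hfg => hst (hfg ▸ rfl))

variable {T} in
theorem IrreducibleUpTo.map (φ : ℕ ↪ ℕ) {S : Finset (Finset ℕ)} (h : T.IrreducibleUpTo S) :
    (T.map φ).IrreducibleUpTo (mapFaces φ S) := by
  intro e he
  rw [map_edges, mem_mapFaces] at he
  obtain ⟨e, he, rfl⟩ := he
  rcases h e he with ⟨t, ht, htf, het⟩ | ⟨s, hs, hes⟩
  · refine Or.inl ⟨t.map φ, ?_, ?_, Finset.map_subset_map.2 het⟩
    · rw [mem_triangles] at ht ⊢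
      refine ⟨by rw [Finset.card_map, ht.1], fun u hu hc => ?_⟩
      obtain ⟨u, hut, rfl⟩ := exists_map_eq_of_subset hu
      rw [Finset.card_map] at hc
      rw [map_edges, map_mem_mapFaces]
      exact ht.2 u hut hc
    · rwa [map_faces, map_mem_mapFaces]
  · exact Or.inr ⟨s.map φ, map_mem_mapFaces.2 hs, Finset.map_subset_map.2 hes⟩

/-- Any triangulation can be relabelled so as to meet another one exactly in a prescribed face. -/
theorem exists_map_meetAt (P : Triangulation) {f f' : Finset ℕ} (hf : f ∈ T.faces)
    (hf' : f' ∈ P.faces) : ∃ φ : ℕ ↪ ℕ, f'.map φ = f ∧ MeetAt T (P.map φ) f := by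
  let ψ : f' ≃ f := Finset.equivOfCardEq (by rw [T.card_eq_three f hf, P.card_eq_three f' hf'])
  obtain ⟨N, hN⟩ : ∃ N, ∀ v ∈ T.verts, v < N :=
    ⟨T.verts.sup id + 1, fun v hv => Nat.lt_succ_of_le (Finset.le_sup (f := id) hv)⟩
  let g : ℕ → ℕ := fun x => if h : x ∈ f' then (ψ ⟨x, h⟩ : ℕ) else x + N
  have gmem : ∀ {x} (h : x ∈ f'), g x = ψ ⟨x, h⟩ := fun h => by simp [g, h]
  have gnot : ∀ {x}, x ∉ f' → g x = x + N := fun h => by simp [g, h]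
  have hlt : ∀ {x}, x ∈ f' → g x < N := fun h => by
    rw [gmem h]
    exact hN _ (T.subset_verts hf (ψ _).2)
  have hg : Function.Injective g := by
    intro x y hxy
    by_cases hx : x ∈ f' <;> by_cases hy : y ∈ f'
    · rw [gmem hx, gmem hy] at hxy
      simpa using ψ.injective (Subtype.ext hxy)
    · have := hlt hx
      have := gnot hy
      omega
    · have := hlt hy
      have := gnot hx
      omega
    · rw [gnot hx, gnot hy] at hxy
      omega
  have hmap : f'.map ⟨g, hg⟩ = f := by
    ext y
    simp only [Finset.mem_map, Function.Embedding.coeFn_mk]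
    constructor
    · rintro ⟨x, hx, rfl⟩
      rw [gmem hx]
      exact (ψ _).2
    · intro hy
      refine ⟨ψ.symm ⟨y, hy⟩, (ψ.symm ⟨y, hy⟩).2, ?_⟩
      rw [gmem (ψ.symm ⟨y, hy⟩).2]
      simp
  have hfP : f ∈ (P.map ⟨g, hg⟩).faces := by
    rw [map_faces, ← hmap, map_mem_mapFaces]
    exact hf'
  refine ⟨⟨g, hg⟩, hmap, hf, hfP, (Finset.subset_inter (T.subset_verts hf)
    ((P.map ⟨g, hg⟩).subset_verts hfP)).antisymm' fun y hy => ?_⟩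
  rw [Finset.mem_inter, map_verts, Finset.mem_map] at hy
  obtain ⟨hyT, x, -, rfl⟩ := hy
  by_cases hx : x ∈ f'
  · rw [← hmap]
    exact Finset.mem_map_of_mem _ hx
  · have h1 := hN _ hyT
    simp only [Function.Embedding.coeFn_mk, gnot hx] at h1
    omega

/-- There is a triangulation of `S_g` with `n` vertices which is irreducible except possibly
along the boundaries of `k` of its faces. -/
def HasPiece (g n k : ℕ) : Prop :=
  ∃ T : Triangulation, T.IsS g ∧ T.verts.card = n ∧
    ∃ S ⊆ T.faces, S.card = k ∧ T.IrreducibleUpTo S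

/-- Connected sum of two pieces along one exceptional face of each. -/
theorem HasPiece.glue {g g' n n' k k' : ℕ} (h : HasPiece g n (k + 1))
    (h' : HasPiece g' n' (k' + 1)) : HasPiece (g + g') (n + n' - 3) (k + k') := by
  obtain ⟨T, ⟨hTe, hTo⟩, rfl, S, hST, hSk, hS⟩ := h
  obtain ⟨P, ⟨hPe, hPo⟩, rfl, S', hSP, hSk', hS'⟩ := h'
  obtain ⟨f, hf⟩ : S.Nonempty := Finset.card_pos.1 (by omega)
  obtain ⟨f', hf'⟩ : S'.Nonempty := Finset.card_pos.1 (by omega)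
  obtain ⟨φ, hφ, hm⟩ := T.exists_map_meetAt P (hST hf) (hSP hf')
  have hfφ : f ∈ mapFaces φ S' := mem_mapFaces.2 ⟨f', hf', hφ⟩
  have hSPφ : mapFaces φ S' ⊆ (P.map φ).faces := Finset.map_subset_map.2 hSP
  refine ⟨hm.glue, ⟨?_, hm.glue_orientable hTo (hPo.map φ)⟩, ?_, _, ?_, ?_,
    hm.glue_irreducibleUpTo hS (hS'.map φ)⟩
  · rw [hm.glue_euler, map_euler, hTe, hPe]
    push_cast
    ring
  · have := hm.card_glue_verts
    rw [map_verts, Finset.card_map] at this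
    omega
  · intro s hs
    rw [hm.mem_glue_faces]
    simp only [Finset.mem_union, Finset.mem_erase] at hs
    rcases hs with hs | hs
    · exact ⟨hs.1, Or.inl (hST hs.2)⟩
    · exact ⟨hs.1, Or.inr (hSPφ hs.2)⟩
  · rw [Finset.card_union_of_disjoint, Finset.card_erase_of_mem hf, Finset.card_erase_of_mem hfφ,
      mapFaces, Finset.card_map, hSk, hSk']
    · omega
    · rw [Finset.disjoint_left]
      intro s h1 h2
      rw [Finset.mem_erase] at h1 h2
      exact h1.1 (hm.eq (hST h1.2) (hSPφ h2.2))

/-- The vertex set of an oriented triangle. -/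
def support (t : ℕ × ℕ × ℕ) : Finset ℕ := {t.1, t.2.1, t.2.2}

/-- The triangles spanned by `v` and consecutive members of a list of neighbours. -/
def fan (v : ℕ) (l : List ℕ) : List (Finset ℕ) :=
  List.zipWith (fun a b => {v, a, b}) l l.tail

/-- A list of oriented triangles, in which consecutive ones share an edge, together with the
lists of neighbours of the vertices in cyclic order, defines a triangulation. -/
def ofList (L : List (ℕ × ℕ × ℕ)) (R : List (List ℕ)) (hL : L ≠ [])
    (hcard : ∀ f ∈ (L.map support).toFinset, f.card = 3)
    (hedge : ∀ f ∈ (L.map support).toFinset, ∀ e ∈ f.powersetCard 2,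
      ((L.map support).toFinset.filter (fun g => e ⊆ g)).card = 2)
    (hchain : (L.map support).IsChain (fun f g => f ∈ (L.map support).toFinset ∧
      g ∈ (L.map support).toFinset ∧ (f ∩ g).card = 2))
    (hlink : ∀ f ∈ (L.map support).toFinset, ∀ v ∈ f, f ∈ fan v (R.getD v []))
    (hfan : ∀ f ∈ (L.map support).toFinset, ∀ v ∈ f, (fan v (R.getD v [])).IsChain
      (fun f g => f ∈ (L.map support).toFinset ∧ g ∈ (L.map support).toFinset ∧
        v ∈ f ∧ v ∈ g ∧ (f ∩ g).card = 2)) : Triangulation where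
  faces := (L.map support).toFinset
  faces_nonempty := by
    rw [List.toFinset_nonempty_iff]
    simpa using hL
  card_eq_three := hcard
  edge_in_two_faces e he := by
    rintro ⟨f, hf, hef⟩
    exact hedge f hf e (Finset.mem_powersetCard.2 ⟨hef, he⟩)
  link_connected v f hf g hg hvf hvg :=
    reflTransGen_of_isChain (fun _ _ h => LinkAdj.symm h) (hfan f hf v hvf) (hlink f hf v hvf)
      (hlink g hg v hvg)
  face_connected _ hf _ hg :=
    reflTransGen_of_isChain (fun _ _ h => FaceAdj.symm h) hchain
      (List.mem_toFinset.1 hf) (List.mem_toFinset.1 hg)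

theorem orientable_of_list (T : Triangulation) (L : List (ℕ × ℕ × ℕ))
    (hT : T.faces = (L.map support).toFinset)
    (hL : L.Pairwise fun s t => Disjoint (dedges s) (dedges t)) : T.Orientable := by
  have hex : ∀ f ∈ T.faces, ∃ t ∈ L, support t = f := by
    intro f hf
    rw [hT] at hf
    simpa using hf
  let σ : Finset ℕ → ℕ × ℕ × ℕ := fun f =>
    if h : ∃ t ∈ L, support t = f then h.choose else (0, 0, 0)
  have hσ : ∀ f ∈ T.faces, σ f ∈ L ∧ support (σ f) = f := by
    intro f hf
    simp only [σ, dif_pos (hex f hf)]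
    exact (hex f hf).choose_spec
  refine ⟨σ, fun f hf => (hσ f hf).2, fun f hf g hg hfg => ?_⟩
  have : Std.Symm fun s t : ℕ × ℕ × ℕ => Disjoint (dedges s) (dedges t) := ⟨fun _ _ h => h.symm⟩
  refine hL.forall (hσ f hf).1 (hσ g hg).1 fun h => ?_
  exact hfg (by rw [← (hσ f hf).2, ← (hσ g hg).2, h])


/-- An irreducible triangulation of the torus with ten vertices, as a list of oriented triangles. -/
def torusList : List (ℕ × ℕ × ℕ) :=
  [(0, 4, 7), (0, 9, 4), (0, 5, 9), (0, 7, 5), (2, 5, 7), (2, 4, 5), (2, 6, 4), (2, 7, 6), (1, 6,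
  7), (1, 5, 6), (1, 9, 5), (1, 7, 9), (7, 8, 9), (4, 8, 7), (4, 6, 8), (6, 9, 8), (3, 9, 6), (3,
  4, 9), (3, 5, 4), (3, 6, 5)]

/-- An irreducible triangulation of the torus with ten vertices. -/
def torus : Triangulation :=
  ofList torusList
    [[4, 7, 5, 9, 4], [5, 6, 7, 9, 5], [4, 5, 7, 6, 4], [4, 5, 6, 9, 4], [0, 7, 8, 6, 2, 5, 3, 9,
    0], [0, 7, 2, 4, 3, 6, 1, 9, 0], [1, 5, 3, 9, 8, 4, 2, 7, 1], [0, 4, 8, 9, 1, 6, 2, 5, 0], [4,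
    6, 9, 7, 4], [0, 4, 3, 6, 8, 7, 1, 5, 0]]
    (by decide +kernel) (by decide +kernel) (by decide +kernel) (by decide +kernel)
    (by decide +kernel) (by decide +kernel)

theorem torus_orientable : torus.Orientable :=
  orientable_of_list _ torusList rfl (by decide +kernel)

/-- The octahedron, as a list of oriented triangles. -/
def octahedronList : List (ℕ × ℕ × ℕ) :=
  [(0, 2, 4), (0, 5, 2), (0, 3, 5), (0, 4, 3), (1, 3, 4), (1, 4, 2), (1, 2, 5), (1, 5, 3)]

/-- The octahedron. -/
def octahedron : Triangulation :=
  ofList octahedronList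
    [[2, 4, 3, 5, 2], [2, 4, 3, 5, 2], [0, 4, 1, 5, 0], [0, 4, 1, 5, 0], [0, 2, 1, 3, 0], [0, 2,
    1, 3, 0]]
    (by decide +kernel) (by decide +kernel) (by decide +kernel) (by decide +kernel)
    (by decide +kernel) (by decide +kernel)

theorem octahedron_orientable : octahedron.Orientable :=
  orientable_of_list _ octahedronList rfl (by decide +kernel)

/-- The tetrahedron, as a list of oriented triangles. -/
def tetrahedronList : List (ℕ × ℕ × ℕ) :=
  [(0, 1, 2), (0, 3, 1), (0, 2, 3), (1, 3, 2)]

/-- The tetrahedron. -/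
def tetrahedron : Triangulation :=
  ofList tetrahedronList
    [[1, 2, 3, 1], [0, 2, 3, 0], [0, 1, 3, 0], [0, 1, 2, 0]]
    (by decide +kernel) (by decide +kernel) (by decide +kernel) (by decide +kernel)
    (by decide +kernel) (by decide +kernel)

theorem tetrahedron_orientable : tetrahedron.Orientable :=
  orientable_of_list _ tetrahedronList rfl (by decide +kernel)

theorem torus_isS : torus.IsS 1 := ⟨by decide +kernel, torus_orientable⟩

theorem octahedron_isS : octahedron.IsS 0 := ⟨by decide +kernel, octahedron_orientable⟩

theorem tetrahedron_isS : tetrahedron.IsS 0 := ⟨by decide +kernel, tetrahedron_orientable⟩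

theorem torus_irreducibleUpTo : torus.IrreducibleUpTo ∅ := by
  unfold IrreducibleUpTo
  decide +kernel

theorem hasPiece_torus_zero : HasPiece 1 10 0 :=
  ⟨torus, torus_isS, by decide +kernel, ∅, by simp, rfl, torus_irreducibleUpTo⟩

theorem hasPiece_torus_one : HasPiece 1 10 1 :=
  ⟨torus, torus_isS, by decide +kernel, {{0, 4, 7}}, by decide +kernel, by decide +kernel,
    fun e he => (torus_irreducibleUpTo e he).imp_right (by simp)⟩

theorem hasPiece_octahedron : HasPiece 0 6 4 :=
  ⟨octahedron, octahedron_isS, by decide +kernel, {{0, 2, 4}, {0, 3, 5}, {1, 3, 4}, {1, 2, 5}},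
    by decide +kernel, by decide +kernel, by unfold IrreducibleUpTo; decide +kernel⟩

theorem hasPiece_tetrahedron : HasPiece 0 4 3 :=
  ⟨tetrahedron, tetrahedron_isS, by decide +kernel, {{0, 1, 2}, {0, 1, 3}, {0, 2, 3}},
    by decide +kernel, by decide +kernel, by unfold IrreducibleUpTo; decide +kernel⟩

/-- Chaining octahedra, each carrying two tori, adds genus two and seventeen vertices per step. -/
theorem hasPiece_chain (n : ℕ) : HasPiece (1 + 2 * n) (10 + 17 * n) 1 := by
  induction n with
  | zero => exact hasPiece_torus_one
  | succ n ih =>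
    have hQ : HasPiece 2 20 2 := (hasPiece_octahedron.glue hasPiece_torus_one).glue
      hasPiece_torus_one
    convert HasPiece.glue (k := 0) (k' := 1) ih hQ using 1 <;> omega

theorem exists_hasPiece_zero {g : ℕ} (hg : 1 ≤ g) : ∃ n, 17 * g / 2 ≤ n ∧ HasPiece g n 0 := by
  obtain ⟨m, rfl | rfl⟩ := Nat.even_or_odd' g
  · obtain ⟨m, rfl⟩ := Nat.exists_eq_add_of_le' (show 1 ≤ m by omega)
    refine ⟨17 * m + 17, by omega, ?_⟩
    convert HasPiece.glue (k := 0) (k' := 0) (hasPiece_chain m) hasPiece_torus_one using 1 <;> omega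
  · obtain rfl | ⟨m, rfl⟩ := m.eq_zero_or_pos.imp_right Nat.exists_eq_add_of_le'
    · exact ⟨10, by omega, hasPiece_torus_zero⟩
    · have hQ : HasPiece 2 18 1 := (hasPiece_tetrahedron.glue hasPiece_torus_one).glue
        hasPiece_torus_one
      refine ⟨25 + 17 * m, by omega, ?_⟩
      convert HasPiece.glue (k := 0) (k' := 0) (hasPiece_chain m) hQ using 1 <;> omega

end Triangulation
/-- For every `g ≥ 1` there is an irreducible triangulation of the orientable surface
`S_g` with at least `⌊17 g / 2⌋` vertices; hence `V_max(S_g) ≥ ⌊17 g / 2⌋`. -/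
theorem vmax_orientable_lower_bound :
    ∀ g : ℕ, 1 ≤ g →
      ∃ T : Triangulation, T.IsS g ∧ T.Irreducible ∧ 17 * g / 2 ≤ T.verts.card := by
  intro g hg
  obtain ⟨n, hn, T, hT, rfl, S, -, hS, hirr⟩ := Triangulation.exists_hasPiece_zero hg
  rw [Finset.card_eq_zero] at hS
  subst hS
  exact ⟨T, hT, hirr.irreducible, hn⟩
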